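/- Let f ⊆ {0,…,d} with 1 ≤ |f| ≤ d−1 (so that f* := {0,…,d}\f has at least 2 elements), and let p ∈ f. Let σ ∈ 𝕊 satisfy uᵀ σ w = 0 for all u, w ∈ span{v_a − v_b : a,b ∈ f} (i.e., σ has no tangential–tangential component along f, σ ∈ 𝒩^f(𝕊)). Let c : f* × f* → R be skew-symmetric. For each m ∈ f* let N_m be a nonzero vector orthogonal to v_a − v_b for all a, b ∈ {0,…,d}\{m} (a normal of the facet of T opposite v_m), and assume ( σ + 2·Σ_{i∈f*, i≠m} c_{mi}·sym(t_{p,c} ⊗ t_{p,i}) )·N_m = 0 for every m ∈ f*. Then σ = 0 and c ≡ 0. (Sub-simplex rigidity: an element of P_0(T; 𝒩^f(𝕊)) ⊕ Φ^f(𝕊) whose normal traces τ n_{F_m} vanish on f for all facets F_m containing f is identically zero.) -/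

import Mathlib

open Matrix Finset

/-- `sym(a ⊗ b) = (a bᵀ + b aᵀ)/2`, the symmetric part of the rank-one matrix `a bᵀ`. -/
noncomputable def symOuter {d : ℕ} (a b : Fin d → ℝ) : Matrix (Fin d) (Fin d) ℝ :=
  (1 / 2 : ℝ) • (Matrix.vecMulVec a b + Matrix.vecMulVec b a)

theorem symOuter_mulVec {d : ℕ} (a b x : Fin d → ℝ) :
    symOuter a b *ᵥ x = (1 / 2 : ℝ) • ((b ⬝ᵥ x) • a + (a ⬝ᵥ x) • b) := by
  simp [symOuter, Matrix.smul_mulVec, Matrix.add_mulVec, Matrix.vecMulVec_mulVec]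

/-- Every vector is a combination of the edge vectors of a `d`-simplex at a given vertex. -/
theorem exists_sum_smul_edge_eq {d : ℕ} {v : Fin (d + 1) → (Fin d → ℝ)}
    (hv : AffineIndependent ℝ v) (p : Fin (d + 1)) (w : Fin d → ℝ) :
    ∃ a : Fin (d + 1) → ℝ, ∑ k, a k • (v k - v p) = w := by
  have htop : vectorSpan ℝ (Set.range v) = ⊤ :=
    hv.vectorSpan_eq_top_of_card_eq_finrank_add_one (by simp)
  rw [vectorSpan_range_eq_span_range_vsub_right ℝ v p] at htop
  exact (Submodule.mem_span_range_iff_exists_fun ℝ).1 (htop ▸ Submodule.mem_top)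

/-- The inner product of a vector with a facet normal only sees the edge leaving the facet. -/
theorem sum_smul_edge_dotProduct {d : ℕ} {v : Fin (d + 1) → (Fin d → ℝ)}
    {p m : Fin (d + 1)} (hpm : p ≠ m) {n : Fin d → ℝ}
    (hn : ∀ a b : Fin (d + 1), a ≠ m → b ≠ m → (v a - v b) ⬝ᵥ n = 0) (a : Fin (d + 1) → ℝ) :
    (∑ k, a k • (v k - v p)) ⬝ᵥ n = a m * ((v m - v p) ⬝ᵥ n) := by
  rw [sum_dotProduct, Finset.sum_eq_single m]
  · simp
  · intro k _ hk
    simp [hn k p hk hpm]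
  · simp

/-- A facet normal is not orthogonal to an edge leaving the facet. -/
theorem edge_dotProduct_ne_zero {d : ℕ} {v : Fin (d + 1) → (Fin d → ℝ)}
    (hv : AffineIndependent ℝ v) {p m : Fin (d + 1)} (hpm : p ≠ m) {n : Fin d → ℝ} (hn0 : n ≠ 0)
    (hn : ∀ a b : Fin (d + 1), a ≠ m → b ≠ m → (v a - v b) ⬝ᵥ n = 0) :
    (v m - v p) ⬝ᵥ n ≠ 0 := by
  intro h
  obtain ⟨a, ha⟩ := exists_sum_smul_edge_eq hv p n
  have := sum_smul_edge_dotProduct hpm hn a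
  rw [ha, h, mul_zero] at this
  exact hn0 (dotProduct_self_eq_zero.1 this)

/-- A vector orthogonal to a face `f` and to the normals of all facets containing `f` vanishes. -/
theorem eq_zero_of_dotProduct_normal_of_dotProduct_edge {d : ℕ} {v : Fin (d + 1) → (Fin d → ℝ)}
    (hv : AffineIndependent ℝ v) {f : Finset (Fin (d + 1))} {p : Fin (d + 1)} (hp : p ∈ f)
    {N : Fin (d + 1) → (Fin d → ℝ)} (hN0 : ∀ m ∉ f, N m ≠ 0)
    (hNorth : ∀ m ∉ f, ∀ a b : Fin (d + 1), a ≠ m → b ≠ m → (v a - v b) ⬝ᵥ N m = 0)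
    {w : Fin d → ℝ} (hwN : ∀ m ∉ f, w ⬝ᵥ N m = 0) (hwf : ∀ k ∈ f, w ⬝ᵥ (v k - v p) = 0) :
    w = 0 := by
  obtain ⟨a, ha⟩ := exists_sum_smul_edge_eq hv p w
  have ha0 : ∀ m ∉ f, a m = 0 := by
    intro m hm
    have hpm : p ≠ m := fun h => hm (h ▸ hp)
    have h := sum_smul_edge_dotProduct hpm (hNorth m hm) a
    rw [ha, hwN m hm] at h
    exact (mul_eq_zero.1 h.symm).resolve_right
      (edge_dotProduct_ne_zero hv hpm (hN0 m hm) (hNorth m hm))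
  rw [← dotProduct_self_eq_zero (v := w)]
  nth_rewrite 2 [← ha]
  rw [dotProduct_sum]
  refine Finset.sum_eq_zero fun k _ => ?_
  by_cases hk : k ∈ f
  · simp [hwf k hk]
  · simp [ha0 k hk]

theorem Matrix.IsSymm.dotProduct_mulVec_comm {n : Type*} [Fintype n] {A : Matrix n n ℝ}
    (hA : A.IsSymm) (x y : n → ℝ) : x ⬝ᵥ (A *ᵥ y) = y ⬝ᵥ (A *ᵥ x) := by
  rw [Matrix.dotProduct_mulVec, ← Matrix.mulVec_transpose, hA.eq, dotProduct_comm]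

/-- sub-simplex rigidity. Let `f ⊆ {0,…,d}` with `1 ≤ |f| ≤ d-1` and
`p ∈ f`. If `σ ∈ 𝒩^f(𝕊)` (no tangential–tangential component along `f`) and `c` is a
skew-symmetric coefficient matrix on `f* × f*` such that the piecewise-constant field
`σ + 2 ∑_{i ∈ f*, i≠m} c_{mi} sym(t_{p,c} ⊗ t_{p,i})` annihilates the facet normal `N_m`
for every `m ∈ f*`, then `σ = 0` and `c ≡ 0`. -/
theorem statement12 (d : ℕ) (hd : 2 ≤ d)
    (v : Fin (d + 1) → (Fin d → ℝ)) (hv : AffineIndependent ℝ v)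
    (vc : Fin d → ℝ) (hvc : vc = ((d : ℝ) + 1)⁻¹ • ∑ k, v k)
    (f : Finset (Fin (d + 1))) (hf1 : 1 ≤ f.card) (hf2 : f.card ≤ d - 1)
    (p : Fin (d + 1)) (hp : p ∈ f)
    (σ : Matrix (Fin d) (Fin d) ℝ) (hσ : σ.IsSymm)
    (hσN : ∀ u ∈ Submodule.span ℝ
        {x : Fin d → ℝ | ∃ a ∈ f, ∃ b ∈ f, x = v a - v b},
      ∀ w ∈ Submodule.span ℝ
        {x : Fin d → ℝ | ∃ a ∈ f, ∃ b ∈ f, x = v a - v b},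
      u ⬝ᵥ (σ *ᵥ w) = 0)
    (c : Fin (d + 1) → Fin (d + 1) → ℝ)
    (hcskew : ∀ a b : Fin (d + 1), a ∉ f → b ∉ f → c a b = - c b a)
    (N : Fin (d + 1) → (Fin d → ℝ))
    (hN0 : ∀ m ∉ f, N m ≠ 0)
    (hNorth : ∀ m ∉ f, ∀ a b : Fin (d + 1), a ≠ m → b ≠ m → (v a - v b) ⬝ᵥ N m = 0)
    (hdof : ∀ m ∉ f,
      (σ + (2 : ℝ) • ∑ i ∈ Finset.univ.filter (fun i : Fin (d + 1) => i ∉ f ∧ i ≠ m),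
        c m i • symOuter (vc - v p) (v i - v p)) *ᵥ N m = 0) :
    σ = 0 ∧ ∀ a b : Fin (d + 1), a ∉ f → b ∉ f → c a b = 0 := by
  have hpne : ∀ m ∉ f, p ≠ m := fun m hm h => hm (h ▸ hp)
  have hs : ∀ m ∉ f, (v m - v p) ⬝ᵥ N m ≠ 0 := fun m hm =>
    edge_dotProduct_ne_zero hv (hpne m hm) (hN0 m hm) (hNorth m hm)
  have hd1 : (d : ℝ) + 1 ≠ 0 := by positivity
  have hvcp : vc - v p = ∑ k, ((d : ℝ) + 1)⁻¹ • (v k - v p) := by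
    rw [← Finset.smul_sum, Finset.sum_sub_distrib, smul_sub, hvc]
    simp [← Nat.cast_smul_eq_nsmul ℝ, smul_smul, hd1]
  have hvcN : ∀ m ∉ f, (vc - v p) ⬝ᵥ N m = ((d : ℝ) + 1)⁻¹ * ((v m - v p) ⬝ᵥ N m) := by
    intro m hm
    rw [hvcp, sum_smul_edge_dotProduct (hpne m hm) (hNorth m hm)]
  have hσNm : ∀ m ∉ f, σ *ᵥ N m = -∑ i ∈ Finset.univ.filter
      (fun i : Fin (d + 1) => i ∉ f ∧ i ≠ m), (c m i * ((vc - v p) ⬝ᵥ N m)) • (v i - v p) := by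
    intro m hm
    have h := hdof m hm
    rw [Matrix.add_mulVec, Matrix.smul_mulVec, Matrix.sum_mulVec, Finset.smul_sum] at h
    rw [eq_neg_iff_add_eq_zero, ← h]
    congr 1
    refine Finset.sum_congr rfl fun i hi => ?_
    rw [Matrix.smul_mulVec, symOuter_mulVec,
      hNorth m hm i p (Finset.mem_filter.1 hi).2.2 (hpne m hm)]
    simp only [zero_smul, zero_add, smul_smul]
    ring_nf
  have hpair : ∀ m ∉ f, ∀ l ∉ f, l ≠ m → N l ⬝ᵥ (σ *ᵥ N m) =
      -(c m l * (((d : ℝ) + 1)⁻¹ * ((v m - v p) ⬝ᵥ N m)) * ((v l - v p) ⬝ᵥ N l)) := by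
    intro m hm l hl hlm
    rw [hσNm m hm, dotProduct_neg, dotProduct_sum, Finset.sum_eq_single l, dotProduct_smul,
      hvcN m hm, dotProduct_comm (N l), smul_eq_mul]
    · intro i _ hil
      rw [dotProduct_smul, dotProduct_comm (N l), hNorth l hl i p hil (hpne l hl), smul_zero]
    · intro h
      simp [hl, hlm] at h
  have hc : ∀ a b : Fin (d + 1), a ∉ f → b ∉ f → c a b = 0 := by
    intro a b ha hb
    have hskew := hcskew a b ha hb
    by_cases hab : b = a
    · subst hab
      linarith
    have h := hσ.dotProduct_mulVec_comm (N b) (N a)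
    rw [hpair a ha b hb hab, hpair b hb a ha (Ne.symm hab)] at h
    have h2 : c a b * (((d : ℝ) + 1)⁻¹ * ((v a - v p) ⬝ᵥ N a) * ((v b - v p) ⬝ᵥ N b)) = 0 := by
      have : c b a = -c a b := by linarith
      rw [this] at h
      linarith
    exact (mul_eq_zero.1 h2).resolve_right
      (mul_ne_zero (mul_ne_zero (inv_ne_zero hd1) (hs a ha)) (hs b hb))
  refine ⟨?_, hc⟩
  have hσN0 : ∀ m ∉ f, σ *ᵥ N m = 0 := by
    intro m hm
    rw [hσNm m hm, neg_eq_zero]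
    refine Finset.sum_eq_zero fun i hi => ?_
    rw [hc m i hm (Finset.mem_filter.1 hi).2.1, zero_mul, zero_smul]
  have horth : ∀ x, ∀ m ∉ f, (σ *ᵥ x) ⬝ᵥ N m = 0 := by
    intro x m hm
    rw [dotProduct_comm, hσ.dotProduct_mulVec_comm, hσN0 m hm, dotProduct_zero]
  have hσf : ∀ k ∈ f, σ *ᵥ (v k - v p) = 0 := by
    intro k hk
    refine eq_zero_of_dotProduct_normal_of_dotProduct_edge hv hp hN0 hNorth (horth _) ?_
    intro j hj
    rw [dotProduct_comm]
    exact hσN _ (Submodule.subset_span ⟨j, hj, p, hp, rfl⟩) _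
      (Submodule.subset_span ⟨k, hk, p, hp, rfl⟩)
  refine Matrix.ext_of_mulVec_single fun i => ?_
  rw [Matrix.zero_mulVec]
  refine eq_zero_of_dotProduct_normal_of_dotProduct_edge hv hp hN0 hNorth (horth _) ?_
  intro k hk
  rw [dotProduct_comm, hσ.dotProduct_mulVec_comm, hσf k hk, dotProduct_zero]
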